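/- arXiv:1809.08154 — 3 statements merged into one kernel-verified Lean document; each statement's English description precedes it below -/
import Mathlib

section
/- Suppose n ≥ 2 and every variable occurs in at least one clause of φ. Then every automorphism of the graph G_φ fixes pointwise every vertex i_l, i_r and i_s for 1 ≤ i < n. -/
open SimpleGraph

/-- A homogeneous 3-XOR formula over the `n` variables `X_0 < X_1 < … < X_{n-1}`:
a finite set of pairwise distinct clauses, each clause being a 3-element subset
of the variables (given as a triple listed in increasing order) and encoding the
equation `x + y + z = 0` over the field `𝔽₂`. -/
structure HomXor (n : ℕ) : Type where
  clauses : Finset (Fin n × Fin n × Fin n)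
  ordered : ∀ c ∈ clauses, c.1 < c.2.1 ∧ c.2.1 < c.2.2

namespace HomXor

variable {n : ℕ}

/-- The assignment `T` satisfies `φ`: in every clause the three variables sum
to `0` over `𝔽₂`. -/
def Satisfies (φ : HomXor n) (T : Fin n → ZMod 2) : Prop :=
  ∀ c ∈ φ.clauses, T c.1 + T c.2.1 + T c.2.2 = 0

/-- The variable `x` occurs in at least one clause of `φ`. -/
def OccursIn (φ : HomXor n) (x : Fin n) : Prop :=
  ∃ c ∈ φ.clauses, x = c.1 ∨ x = c.2.1 ∨ x = c.2.2

/-- The vertices of the graph `G_φ`: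
* `cl c a b` is the clause vertex `C_{a b (a+b)}` — note that
  `{C_{000}, C_{011}, C_{110}, C_{101}}` is exactly the set of `C_{a b c}`
  with `a + b + c = 0` in `𝔽₂`, so the four clause vertices of `C` are
  `cl c a b` for `(a, b) ∈ 𝔽₂ × 𝔽₂`;
* `var x v` is the variable vertex `X_x^v`;
* `lt i`, `rt i`, `st i` are the vertices `i_l`, `i_r`, `i_s` — here `i`
  ranges over `Fin (n-1)`, with `i : Fin (n-1)` representing the paper's
  (1-based) index `i+1`, so in terms of 0-based variable indices the vertex
  `lt i` is attached to the variable `i` and `rt i` to the variable `i+1`. -/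
inductive Vtx (φ : HomXor n) : Type
  | cl (c : {c // c ∈ φ.clauses}) (a b : ZMod 2)
  | var (x : Fin n) (v : ZMod 2)
  | lt (i : Fin (n - 1))
  | rt (i : Fin (n - 1))
  | st (i : Fin (n - 1))
  deriving DecidableEq

/-- The variable attached to `i_l` (the paper's `X_i`), as an element of `Fin n`. -/
def low (i : Fin (n - 1)) : Fin n := ⟨i.1, lt_of_lt_of_le i.2 (Nat.sub_le n 1)⟩

/-- The variable attached to `i_r` (the paper's `X_{i+1}`), as an element of `Fin n`. -/
def high (i : Fin (n - 1)) : Fin n := ⟨i.1 + 1, by have := i.2; omega⟩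

/-- The edges of the graph `G_φ`.  For a clause `C` with variables
`x < y < z`, the clause vertex `C_{a b (a+b)}` is adjacent to `x^{1+a}`,
`y^{1+b}` and `z^{1+a+b}` (this is exactly: `C_{000}` adjacent to
`x^1, y^1, z^1`; `C_{011}` to `x^1, y^0, z^0`; `C_{110}` to `x^0, y^0, z^1`;
`C_{101}` to `x^0, y^1, z^0`).  For each variable `X` there is an edge between
`X^0` and `X^1`, and for each `i` there are the asymmetry-gadget edges
`{i_l, i_r}`, `{i_r, i_s}`, `{i_l, X_i^0}`, `{i_l, X_i^1}`, `{i_r, X_{i+1}^0}`,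
`{i_r, X_{i+1}^1}`. -/
inductive Edge (φ : HomXor n) : Vtx φ → Vtx φ → Prop
  | cx (c : {c // c ∈ φ.clauses}) (a b : ZMod 2) :
      Edge φ (Vtx.cl c a b) (Vtx.var c.1.1 (1 + a))
  | cy (c : {c // c ∈ φ.clauses}) (a b : ZMod 2) :
      Edge φ (Vtx.cl c a b) (Vtx.var c.1.2.1 (1 + b))
  | cz (c : {c // c ∈ φ.clauses}) (a b : ZMod 2) :
      Edge φ (Vtx.cl c a b) (Vtx.var c.1.2.2 (1 + a + b))
  | xx (x : Fin n) : Edge φ (Vtx.var x 0) (Vtx.var x 1)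
  | lr (i : Fin (n - 1)) : Edge φ (Vtx.lt i) (Vtx.rt i)
  | rs (i : Fin (n - 1)) : Edge φ (Vtx.rt i) (Vtx.st i)
  | lv (i : Fin (n - 1)) (v : ZMod 2) : Edge φ (Vtx.lt i) (Vtx.var (low i) v)
  | rv (i : Fin (n - 1)) (v : ZMod 2) : Edge φ (Vtx.rt i) (Vtx.var (high i) v)

/-- The graph `G_φ`. -/
def G (φ : HomXor n) : SimpleGraph (Vtx φ) := SimpleGraph.fromRel (Edge φ)

end HomXor

namespace HomXor

variable {n : ℕ} {φ : HomXor n}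

lemma Edge.ne {u v : Vtx φ} (h : Edge φ u v) : u ≠ v := by
  cases h <;> simp

lemma Edge.adj {u v : Vtx φ} (h : Edge φ u v) : (G φ).Adj u v :=
  ⟨h.ne, Or.inl h⟩

lemma adj_iff {u v : Vtx φ} : (G φ).Adj u v ↔ Edge φ u v ∨ Edge φ v u :=
  ⟨fun h => h.2, fun h => h.elim Edge.adj fun h => h.adj.symm⟩

lemma adj_st_iff {i : Fin (n - 1)} {u : Vtx φ} :
    (G φ).Adj (Vtx.st i) u ↔ u = Vtx.rt i := by
  rw [adj_iff]
  constructor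
  · rintro (h | h) <;> cases h
    rfl
  · rintro rfl
    exact Or.inr (Edge.rs i)

lemma adj_rt_iff {i : Fin (n - 1)} {u : Vtx φ} :
    (G φ).Adj (Vtx.rt i) u ↔
      u = Vtx.lt i ∨ u = Vtx.st i ∨ ∃ v, u = Vtx.var (high i) v := by
  rw [adj_iff]
  constructor
  · rintro (h | h) <;> cases h <;> simp
  · rintro (rfl | rfl | ⟨v, rfl⟩)
    · exact Or.inr (Edge.lr i)
    · exact Or.inl (Edge.rs i)
    · exact Or.inl (Edge.rv i v)

lemma adj_lt_iff {i : Fin (n - 1)} {u : Vtx φ} :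
    (G φ).Adj (Vtx.lt i) u ↔ u = Vtx.rt i ∨ ∃ v, u = Vtx.var (low i) v := by
  rw [adj_iff]
  constructor
  · rintro (h | h) <;> cases h <;> simp
  · rintro (rfl | ⟨v, rfl⟩)
    · exact Or.inl (Edge.lr i)
    · exact Or.inl (Edge.lv i v)

lemma low_ne_high (i : Fin (n - 1)) : low i ≠ high i := by
  simp [low, high]

lemma adj_var_add_one (x : Fin n) (v : ZMod 2) :
    (G φ).Adj (Vtx.var x v) (Vtx.var x (v + 1)) := by
  fin_cases v
  · exact (Edge.xx x).adj
  · exact (Edge.xx x).adj.symm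

lemma exists_adj_var_gadget (hn : 2 ≤ n) (x : Fin n) (v : ZMod 2) :
    ∃ i : Fin (n - 1),
      (G φ).Adj (Vtx.var x v) (Vtx.lt i) ∨ (G φ).Adj (Vtx.var x v) (Vtx.rt i) := by
  by_cases hx : x.1 < n - 1
  · exact ⟨⟨x.1, hx⟩, Or.inl (Edge.lv ⟨x.1, hx⟩ v).adj.symm⟩
  · refine ⟨⟨n - 2, by omega⟩, Or.inr ?_⟩
    have h : x = high ⟨n - 2, by omega⟩ := by
      ext
      simp only [high]
      omega
    rw [h]
    exact (Edge.rv _ v).adj.symm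

/-- The leaves of `G_φ` are exactly the vertices `i_s`. -/
lemma existsUnique_adj_iff (hn : 2 ≤ n) {u : Vtx φ} :
    (∃! w, (G φ).Adj u w) ↔ ∃ i, u = Vtx.st i := by
  constructor
  · intro h
    cases u with
    | cl c a b =>
      have := h.unique (Edge.cx c a b).adj (Edge.cy c a b).adj
      simp only [Vtx.var.injEq] at this
      exact absurd this.1 (φ.ordered c.1 c.2).1.ne
    | var x v =>
      obtain ⟨i, hi | hi⟩ := exists_adj_var_gadget hn x v <;>
        cases h.unique hi (adj_var_add_one x v)
    | lt i => cases h.unique (Edge.lr i).adj (Edge.lv i 0).adj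
    | rt i => cases h.unique (Edge.lr i).adj.symm (Edge.rs i).adj
    | st i => exact ⟨i, rfl⟩
  · rintro ⟨i, rfl⟩
    exact ⟨Vtx.rt i, adj_st_iff.2 rfl, fun _ => adj_st_iff.1⟩

lemma no_common_neighbor_lt_rt {i : Fin (n - 1)} {u : Vtx φ}
    (hl : (G φ).Adj (Vtx.lt i) u) (hr : (G φ).Adj (Vtx.rt i) u) : False := by
  rcases adj_lt_iff.1 hl with rfl | ⟨v, rfl⟩
  · exact hr.ne rfl
  · simpa [low_ne_high] using adj_rt_iff.1 hr

/-- An automorphism of `G_φ` permutes the gadgets. -/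
lemma exists_map_gadget (hn : 2 ≤ n) (α : G φ ≃g G φ) (i : Fin (n - 1)) :
    ∃ j, α (Vtx.lt i) = Vtx.lt j ∧ α (Vtx.rt i) = Vtx.rt j ∧
      α (Vtx.st i) = Vtx.st j := by
  obtain ⟨j, hs⟩ : ∃ j, α (Vtx.st i) = Vtx.st j := by
    refine (existsUnique_adj_iff hn).1
      ⟨α (Vtx.rt i), α.map_adj_iff.2 (adj_st_iff.2 rfl), fun w hw => ?_⟩
    obtain ⟨w, rfl⟩ := α.surjective w
    rw [adj_st_iff.1 (α.map_adj_iff.1 hw)]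
  have hr : α (Vtx.rt i) = Vtx.rt j := by
    rw [← adj_st_iff, ← hs, α.map_adj_iff, adj_st_iff]
  refine ⟨j, ?_, hr, hs⟩
  have hlr : (G φ).Adj (Vtx.rt j) (α (Vtx.lt i)) := by
    rw [← hr, α.map_adj_iff]
    exact (Edge.lr i).adj.symm
  rcases adj_rt_iff.1 hlr with h | h | ⟨v, h⟩
  · exact h
  · cases α.injective (h.trans hs.symm)
  · obtain ⟨u, hu⟩ := α.surjective (Vtx.var (high j) (v + 1))
    refine (no_common_neighbor_lt_rt (u := u) (i := i) ?_ ?_).elim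
    · rw [← α.map_adj_iff, h, hu]
      exact adj_var_add_one _ _
    · rw [← α.map_adj_iff, hr, hu]
      exact (Edge.rv j _).adj

lemma map_var_low {α : G φ ≃g G φ} {i j : Fin (n - 1)}
    (hl : α (Vtx.lt i) = Vtx.lt j) (hr : α (Vtx.rt i) = Vtx.rt j) (v : ZMod 2) :
    ∃ w, α (Vtx.var (low i) v) = Vtx.var (low j) w := by
  have h := α.map_adj_iff.2 (Edge.lv (φ := φ) i v).adj
  rw [hl] at h
  rcases adj_lt_iff.1 h with h | h
  · cases α.injective (h.trans hr.symm)
  · exact h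

lemma map_var_high {α : G φ ≃g G φ} {i j : Fin (n - 1)}
    (hl : α (Vtx.lt i) = Vtx.lt j) (hr : α (Vtx.rt i) = Vtx.rt j)
    (hs : α (Vtx.st i) = Vtx.st j) (v : ZMod 2) :
    ∃ w, α (Vtx.var (high i) v) = Vtx.var (high j) w := by
  have h := α.map_adj_iff.2 (Edge.rv (φ := φ) i v).adj
  rw [hr] at h
  rcases adj_rt_iff.1 h with h | h | h
  · cases α.injective (h.trans hl.symm)
  · cases α.injective (h.trans hs.symm)
  · exact h

end HomXor

/-- A self-map of `Fin m` commuting with the successor is the identity. -/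
lemma Fin.eq_self_of_map_succ {m : ℕ} (σ : Fin m → Fin m)
    (h : ∀ i j : Fin m, j.1 = i.1 + 1 → (σ j).1 = (σ i).1 + 1) (i : Fin m) : σ i = i := by
  have key : ∀ k (hk : k < m), (σ ⟨k, hk⟩).1 = (σ ⟨0, by omega⟩).1 + k := by
    intro k
    induction k with
    | zero => simp
    | succ k ih =>
      intro hk
      rw [h ⟨k, by omega⟩ ⟨k + 1, hk⟩ rfl, ih, add_assoc]
  have hi := i.2
  have hlast := key (m - 1) (by omega)
  have hlt := (σ ⟨m - 1, by omega⟩).2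
  ext
  rw [key i.1 hi]
  omega

open HomXor in
/-- If `n ≥ 2` and every variable occurs in at least one clause of `φ`, then
every automorphism of `G_φ` fixes pointwise every vertex `i_l`, `i_r`, `i_s`. -/
theorem automorphism_fixes_gadget_pointwise {n : ℕ} (φ : HomXor n) (hn : 2 ≤ n)
    (hocc : ∀ x : Fin n, φ.OccursIn x) (α : G φ ≃g G φ) :
    ∀ i : Fin (n - 1),
      α (Vtx.lt i) = Vtx.lt i ∧ α (Vtx.rt i) = Vtx.rt i ∧
        α (Vtx.st i) = Vtx.st i := by
  choose σ hl hr hs using exists_map_gadget hn α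
  have hσ : ∀ i, σ i = i := by
    refine Fin.eq_self_of_map_succ σ fun i j hij => ?_
    have hx : low j = high i := Fin.ext hij
    obtain ⟨v, hv⟩ := map_var_low (hl j) (hr j) 0
    obtain ⟨w, hw⟩ := map_var_high (hl i) (hr i) (hs i) 0
    rw [hx, hw, Vtx.var.injEq] at hv
    exact (congrArg Fin.val hv.1).symm
  intro i
  have h : _ ∧ _ ∧ _ := ⟨hl i, hr i, hs i⟩
  rwa [hσ] at h
end

section
/- Suppose n ≥ 2 and every variable occurs in at least one clause of the homogeneous 3-XOR formula φ. Then the map T ↦ α_T is a bijection from the set of satisfying assignments of φ to the set of automorphisms of the graph G_φ. -/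
open SimpleGraph

namespace HomXor

/-- For an assignment `T`, the map `α_T` on the vertices of `G_φ`: each
variable vertex `X^b` is mapped to `X^{b + T(X)}`; each clause vertex
`C_{a b (a+b)}` (for a clause with variables `x < y < z`) is mapped to
`C_{a + T(x), b + T(y), (a+b) + T(z)}` — in our indexing by the first two
subscripts, to `cl c (a + T x) (b + T y)`, which is the same vertex since
`T(x) + T(y) + T(z) = 0` for a satisfying assignment; and every vertex
`i_l`, `i_r`, `i_s` is fixed. -/
def alphaMap {n : ℕ} (φ : HomXor n) (T : Fin n → ZMod 2) : Vtx φ → Vtx φ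
  | Vtx.cl c a b => Vtx.cl c (a + T c.1.1) (b + T c.1.2.1)
  | Vtx.var x v => Vtx.var x (v + T x)
  | u => u

end HomXor

namespace HomXor

section Adjacency

variable {n : ℕ} {φ : HomXor n}

theorem adj_iff_edge {u v : Vtx φ} (huv : u ≠ v) :
    (G φ).Adj u v ↔ Edge φ u v ∨ Edge φ v u := by
  simp [G, SimpleGraph.fromRel_adj, huv]

@[simp] theorem not_adj_cl_cl (c a b c' a' b') :
    ¬ (G φ).Adj (Vtx.cl c a b) (Vtx.cl c' a' b') := by
  rw [G, SimpleGraph.fromRel_adj]; rintro ⟨-, h | h⟩ <;> cases h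

@[simp] theorem adj_cl_var (c a b x v) :
    (G φ).Adj (Vtx.cl c a b) (Vtx.var x v) ↔
      (x = c.1.1 ∧ v = 1 + a) ∨ (x = c.1.2.1 ∧ v = 1 + b) ∨
        (x = c.1.2.2 ∧ v = 1 + a + b) := by
  rw [adj_iff_edge (by simp)]
  constructor
  · rintro (h | h) <;> cases h <;> simp
  · rintro (⟨rfl, rfl⟩ | ⟨rfl, rfl⟩ | ⟨rfl, rfl⟩)
    exacts [.inl (.cx c a b), .inl (.cy c a b), .inl (.cz c a b)]

@[simp] theorem adj_var_cl (c a b x v) :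
    (G φ).Adj (Vtx.var x v) (Vtx.cl c a b) ↔
      (x = c.1.1 ∧ v = 1 + a) ∨ (x = c.1.2.1 ∧ v = 1 + b) ∨
        (x = c.1.2.2 ∧ v = 1 + a + b) := by
  rw [SimpleGraph.adj_comm, adj_cl_var]

@[simp] theorem not_adj_cl_lt (c a b i) : ¬ (G φ).Adj (Vtx.cl c a b) (Vtx.lt i) := by
  rw [adj_iff_edge (by simp)]; rintro (h | h) <;> cases h

@[simp] theorem not_adj_lt_cl (c a b i) : ¬ (G φ).Adj (Vtx.lt i) (Vtx.cl c a b) := by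
  rw [SimpleGraph.adj_comm]; simp

@[simp] theorem not_adj_cl_rt (c a b i) : ¬ (G φ).Adj (Vtx.cl c a b) (Vtx.rt i) := by
  rw [adj_iff_edge (by simp)]; rintro (h | h) <;> cases h

@[simp] theorem not_adj_rt_cl (c a b i) : ¬ (G φ).Adj (Vtx.rt i) (Vtx.cl c a b) := by
  rw [SimpleGraph.adj_comm]; simp

@[simp] theorem not_adj_cl_st (c a b i) : ¬ (G φ).Adj (Vtx.cl c a b) (Vtx.st i) := by
  rw [adj_iff_edge (by simp)]; rintro (h | h) <;> cases h

@[simp] theorem not_adj_st_cl (c a b i) : ¬ (G φ).Adj (Vtx.st i) (Vtx.cl c a b) := by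
  rw [SimpleGraph.adj_comm]; simp

@[simp] theorem adj_var_var (x v y w) :
    (G φ).Adj (Vtx.var x v) (Vtx.var y w) ↔ x = y ∧ v ≠ w := by
  rw [G, SimpleGraph.fromRel_adj]
  constructor
  · rintro ⟨h, h' | h'⟩ <;> cases h' <;> simp
  · rintro ⟨rfl, h⟩
    refine ⟨by simpa using h, ?_⟩
    fin_cases v <;> fin_cases w
    exacts [absurd rfl h, .inl (.xx x), .inr (.xx x), absurd rfl h]

@[simp] theorem adj_lt_var (i x v) :
    (G φ).Adj (Vtx.lt i) (Vtx.var x v) ↔ x = low i := by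
  rw [adj_iff_edge (by simp)]
  constructor
  · rintro (h | h) <;> cases h; rfl
  · rintro rfl; exact .inl (.lv i v)

@[simp] theorem adj_var_lt (i x v) :
    (G φ).Adj (Vtx.var x v) (Vtx.lt i) ↔ x = low i := by
  rw [SimpleGraph.adj_comm, adj_lt_var]

@[simp] theorem adj_rt_var (i x v) :
    (G φ).Adj (Vtx.rt i) (Vtx.var x v) ↔ x = high i := by
  rw [adj_iff_edge (by simp)]
  constructor
  · rintro (h | h) <;> cases h; rfl
  · rintro rfl; exact .inl (.rv i v)

@[simp] theorem adj_var_rt (i x v) :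
    (G φ).Adj (Vtx.var x v) (Vtx.rt i) ↔ x = high i := by
  rw [SimpleGraph.adj_comm, adj_rt_var]

@[simp] theorem not_adj_var_st (x v i) : ¬ (G φ).Adj (Vtx.var x v) (Vtx.st i) := by
  rw [adj_iff_edge (by simp)]; rintro (h | h) <;> cases h

@[simp] theorem not_adj_st_var (x v i) : ¬ (G φ).Adj (Vtx.st i) (Vtx.var x v) := by
  rw [SimpleGraph.adj_comm]; simp

@[simp] theorem not_adj_lt_lt (i j) : ¬ (G φ).Adj (Vtx.lt i) (Vtx.lt j) := by
  rw [G, SimpleGraph.fromRel_adj]; rintro ⟨-, h | h⟩ <;> cases h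

@[simp] theorem adj_lt_rt (i j) : (G φ).Adj (Vtx.lt i) (Vtx.rt j) ↔ i = j := by
  rw [adj_iff_edge (by simp)]
  constructor
  · rintro (h | h) <;> cases h; rfl
  · rintro rfl; exact .inl (.lr i)

@[simp] theorem adj_rt_lt (i j) : (G φ).Adj (Vtx.rt j) (Vtx.lt i) ↔ i = j := by
  rw [SimpleGraph.adj_comm, adj_lt_rt]

@[simp] theorem not_adj_lt_st (i j) : ¬ (G φ).Adj (Vtx.lt i) (Vtx.st j) := by
  rw [adj_iff_edge (by simp)]; rintro (h | h) <;> cases h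

@[simp] theorem not_adj_st_lt (i j) : ¬ (G φ).Adj (Vtx.st j) (Vtx.lt i) := by
  rw [SimpleGraph.adj_comm]; simp

@[simp] theorem not_adj_rt_rt (i j) : ¬ (G φ).Adj (Vtx.rt i) (Vtx.rt j) := by
  rw [G, SimpleGraph.fromRel_adj]; rintro ⟨-, h | h⟩ <;> cases h

@[simp] theorem adj_rt_st (i j) : (G φ).Adj (Vtx.rt i) (Vtx.st j) ↔ i = j := by
  rw [adj_iff_edge (by simp)]
  constructor
  · rintro (h | h) <;> cases h; rfl
  · rintro rfl; exact .inl (.rs i)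

@[simp] theorem adj_st_rt (i j) : (G φ).Adj (Vtx.st j) (Vtx.rt i) ↔ i = j := by
  rw [SimpleGraph.adj_comm, adj_rt_st]

@[simp] theorem not_adj_st_st (i j) : ¬ (G φ).Adj (Vtx.st i) (Vtx.st j) := by
  rw [G, SimpleGraph.fromRel_adj]; rintro ⟨-, h | h⟩ <;> cases h

theorem exists_low_or_high (hn : 2 ≤ n) (x : Fin n) :
    ∃ i : Fin (n - 1), x = low i ∨ x = high i := by
  by_cases hx : x.1 = 0
  · exact ⟨⟨0, by omega⟩, .inl (Fin.ext (by simp [low, hx]))⟩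
  · exact ⟨⟨x.1 - 1, by omega⟩, .inr (Fin.ext (by simp [high]; omega))⟩

/-- Every variable vertex is adjacent to a clause vertex that is not adjacent to
the opposite variable vertex. -/
theorem exists_cl_adj {x : Fin n} (hx : φ.OccursIn x) (v : ZMod 2) :
    ∃ c a b, (G φ).Adj (Vtx.var x v) (Vtx.cl c a b) ∧
      ¬ (G φ).Adj (Vtx.var x (v + 1)) (Vtx.cl c a b) := by
  obtain ⟨c, hc, h⟩ := hx
  have ho := φ.ordered c hc
  have h₁ : v = 1 + (v + 1) := by revert v; decide
  have h₂ : v + 1 ≠ v := by revert v; decide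
  have h₃ := ho.1.ne
  have h₄ := ho.2.ne
  have h₅ := (ho.1.trans ho.2).ne
  rcases h with rfl | rfl | rfl
  · exact ⟨⟨c, hc⟩, v + 1, 0, by simp [← h₁], by simp [← h₁, h₃, h₅]⟩
  · exact ⟨⟨c, hc⟩, 0, v + 1, by simp [← h₁], by simp [← h₁, h₃.symm, h₄]⟩
  · exact ⟨⟨c, hc⟩, 0, v + 1, by simp [← h₁], by simp [← h₁, h₄.symm, h₅.symm]⟩

end Adjacency

section Classes

variable {n : ℕ} {φ : HomXor n}

def IsSt (u : Vtx φ) : Prop := ∃ i, u = Vtx.st i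

def IsRt (u : Vtx φ) : Prop := ∃ i, u = Vtx.rt i

def IsLt (u : Vtx φ) : Prop := ∃ i, u = Vtx.lt i

def IsVar (u : Vtx φ) : Prop := ∃ x v, u = Vtx.var x v

theorem isSt_iff (hocc : ∀ x : Fin n, φ.OccursIn x) (u : Vtx φ) :
    IsSt u ↔ ∀ v w, (G φ).Adj u v → (G φ).Adj u w → v = w := by
  constructor
  · rintro ⟨i, rfl⟩ v w hv hw
    cases v <;> cases w <;> simp_all
  · intro h
    cases u with
    | cl c a b =>
      have := h (.var c.1.1 (1 + a)) (.var c.1.2.1 (1 + b)) (by simp) (by simp)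
      simp only [Vtx.var.injEq] at this
      exact absurd this.1 (φ.ordered _ c.2).1.ne
    | var x v =>
      obtain ⟨c, a, b, hc, -⟩ := exists_cl_adj (hocc x) v
      have := h (.cl c a b) (.var x (v + 1)) hc (by simp)
      simp at this
    | lt i =>
      have := h (.var (low i) 0) (.rt i) (by simp) (by simp)
      simp at this
    | rt i =>
      have := h (.st i) (.lt i) (by simp) (by simp)
      simp at this
    | st i => exact ⟨i, rfl⟩

theorem isRt_iff (u : Vtx φ) : IsRt u ↔ ∃ v, IsSt v ∧ (G φ).Adj u v := by
  constructor
  · rintro ⟨i, rfl⟩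
    exact ⟨.st i, ⟨i, rfl⟩, by simp⟩
  · rintro ⟨_, ⟨i, rfl⟩, h⟩
    cases u with
    | rt i => exact ⟨i, rfl⟩
    | _ => simp at h

theorem isLt_iff (hocc : ∀ x : Fin n, φ.OccursIn x) (u : Vtx φ) :
    IsLt u ↔ ¬ IsSt u ∧ (∃ v, IsRt v ∧ (G φ).Adj u v) ∧
      ∀ v w, ¬ IsRt v → ¬ IsRt w → (G φ).Adj u v → (G φ).Adj u w → v ≠ w →
        (G φ).Adj v w := by
  constructor
  · rintro ⟨i, rfl⟩
    refine ⟨by simp [IsSt], ⟨.rt i, ⟨i, rfl⟩, by simp⟩, ?_⟩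
    intro v w hv hw hav haw hvw
    cases v <;> cases w <;> simp_all [IsRt]
  · rintro ⟨hs, ⟨_, ⟨i, rfl⟩, h⟩, hP⟩
    cases u with
    | lt i => exact ⟨i, rfl⟩
    | st i => exact absurd ⟨i, rfl⟩ hs
    | var x v =>
      obtain ⟨c, a, b, hc, hc'⟩ := exists_cl_adj (hocc x) v
      exact absurd (hP (.var x (v + 1)) (.cl c a b) (by simp [IsRt]) (by simp [IsRt])
        (by simp) hc (by simp)) hc'
    | _ => simp at h

theorem isVar_iff (hn : 2 ≤ n) (u : Vtx φ) :
    IsVar u ↔ ¬ IsSt u ∧ ¬ IsRt u ∧ ¬ IsLt u ∧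
      ∃ v, (IsLt v ∨ IsRt v) ∧ (G φ).Adj u v := by
  constructor
  · rintro ⟨x, v, rfl⟩
    refine ⟨by simp [IsSt], by simp [IsRt], by simp [IsLt], ?_⟩
    obtain ⟨i, rfl | rfl⟩ := exists_low_or_high hn x
    · exact ⟨.lt i, .inl ⟨i, rfl⟩, by simp⟩
    · exact ⟨.rt i, .inr ⟨i, rfl⟩, by simp⟩
  · rintro ⟨hs, hr, hl, v, hv, h⟩
    cases u with
    | var x v => exact ⟨x, v, rfl⟩
    | lt i => exact absurd ⟨i, rfl⟩ hl
    | rt i => exact absurd ⟨i, rfl⟩ hr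
    | st i => exact absurd ⟨i, rfl⟩ hs
    | cl c a b =>
      rcases hv with ⟨i, rfl⟩ | ⟨i, rfl⟩ <;> simp at h

variable (α : G φ ≃g G φ)

theorem isSt_apply (hocc : ∀ x : Fin n, φ.OccursIn x) (u : Vtx φ) :
    IsSt (α u) ↔ IsSt u := by
  rw [isSt_iff hocc, isSt_iff hocc, α.surjective.forall₂]
  simp [α.map_adj_iff]

theorem isRt_apply (hocc : ∀ x : Fin n, φ.OccursIn x) (u : Vtx φ) :
    IsRt (α u) ↔ IsRt u := by
  rw [isRt_iff, isRt_iff, α.surjective.exists]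
  simp [α.map_adj_iff, isSt_apply α hocc]

theorem isLt_apply (hocc : ∀ x : Fin n, φ.OccursIn x) (u : Vtx φ) :
    IsLt (α u) ↔ IsLt u := by
  rw [isLt_iff hocc, isLt_iff hocc, α.surjective.forall₂, α.surjective.exists]
  simp [α.map_adj_iff, isSt_apply α hocc, isRt_apply α hocc]

theorem isVar_apply (hn : 2 ≤ n) (hocc : ∀ x : Fin n, φ.OccursIn x) (u : Vtx φ) :
    IsVar (α u) ↔ IsVar u := by
  rw [isVar_iff hn, isVar_iff hn, α.surjective.exists]
  simp [α.map_adj_iff, isSt_apply α hocc, isRt_apply α hocc, isLt_apply α hocc]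

end Classes

section Automorphisms

variable {n : ℕ} {φ : HomXor n}

/-- A self-map of an initial segment that commutes with the successor is the identity. -/
theorem eq_self_of_succ {m : ℕ} (σ : Fin m → Fin m)
    (h : ∀ i j : Fin m, j.1 = i.1 + 1 → (σ j).1 = (σ i).1 + 1) (i : Fin m) : σ i = i := by
  have hm : 0 < m := i.pos
  have key : ∀ k (hk : k < m), (σ ⟨k, hk⟩).1 = (σ ⟨0, hm⟩).1 + k := by
    intro k
    induction k with
    | zero => intro _; rfl
    | succ k ih =>
      intro hk
      rw [h ⟨k, by omega⟩ ⟨k + 1, hk⟩ rfl, ih]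
      omega
  have hlast := key (m - 1) (by omega)
  have hlt := (σ ⟨m - 1, by omega⟩).2
  have hi := key i.1 i.2
  ext
  simp only [Fin.eta] at hi
  omega

theorem gadget_fixed (α : G φ ≃g G φ) (hn : 2 ≤ n) (hocc : ∀ x : Fin n, φ.OccursIn x) :
    (∀ i, α (.st i) = .st i) ∧ (∀ i, α (.rt i) = .rt i) ∧ (∀ i, α (.lt i) = .lt i) ∧
      ∀ x v, ∃ w, α (.var x v) = .var x w := by
  have hst : ∀ i, ∃ j, α (.st i) = .st j := fun i => (isSt_apply α hocc _).2 ⟨i, rfl⟩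
  choose σ hσ using hst
  have hrt : ∀ i, α (.rt i) = .rt (σ i) := by
    intro i
    obtain ⟨j, hj⟩ := (isRt_apply α hocc (.rt i)).2 ⟨i, rfl⟩
    have h : (G φ).Adj (α (.rt i)) (α (.st i)) := α.map_adj_iff.2 (by simp)
    rw [hj, hσ, adj_rt_st] at h
    rw [hj, h]
  have hlt : ∀ i, α (.lt i) = .lt (σ i) := by
    intro i
    obtain ⟨j, hj⟩ := (isLt_apply α hocc (.lt i)).2 ⟨i, rfl⟩
    have h : (G φ).Adj (α (.lt i)) (α (.rt i)) := α.map_adj_iff.2 (by simp)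
    rw [hj, hrt, adj_lt_rt] at h
    rw [hj, h]
  have hlow : ∀ i v, ∃ w, α (.var (low i) v) = .var (low (σ i)) w := by
    intro i v
    obtain ⟨x, w, hx⟩ := (isVar_apply α hn hocc (.var (low i) v)).2 ⟨_, _, rfl⟩
    have h : (G φ).Adj (α (.lt i)) (α (.var (low i) v)) := α.map_adj_iff.2 (by simp)
    rw [hx, hlt, adj_lt_var] at h
    exact ⟨w, by rw [hx, h]⟩
  have hhigh : ∀ i v, ∃ w, α (.var (high i) v) = .var (high (σ i)) w := by
    intro i v
    obtain ⟨x, w, hx⟩ := (isVar_apply α hn hocc (.var (high i) v)).2 ⟨_, _, rfl⟩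
    have h : (G φ).Adj (α (.rt i)) (α (.var (high i) v)) := α.map_adj_iff.2 (by simp)
    rw [hx, hrt, adj_rt_var] at h
    exact ⟨w, by rw [hx, h]⟩
  have hid : ∀ i, σ i = i := by
    refine eq_self_of_succ σ fun i j hij => ?_
    obtain ⟨w, hw⟩ := hlow j 0
    obtain ⟨w', hw'⟩ := hhigh i 0
    have hx : low j = high i := Fin.ext hij
    rw [hx, hw'] at hw
    have := congrArg Fin.val (Vtx.var.inj hw).1
    exact this.symm
  simp only [hid] at hσ hrt hlt hlow hhigh
  refine ⟨hσ, hrt, hlt, fun x v => ?_⟩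
  obtain ⟨i, rfl | rfl⟩ := exists_low_or_high hn x
  exacts [hlow i v, hhigh i v]

theorem exists_shift (α : G φ ≃g G φ) (hn : 2 ≤ n) (hocc : ∀ x : Fin n, φ.OccursIn x) :
    ∃ T : Fin n → ZMod 2, ∀ x v, α (.var x v) = .var x (v + T x) := by
  choose g hg using (gadget_fixed α hn hocc).2.2.2
  refine ⟨fun x => g x 0, fun x v => ?_⟩
  have hne : g x 0 ≠ g x 1 := by
    intro h
    have : α (.var x 0) = α (.var x 1) := by rw [hg, hg, h]
    simpa using α.injective this
  have h01 : ∀ p q : ZMod 2, p ≠ q → q = 1 + p := by decide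
  rw [hg]
  fin_cases v
  · exact congrArg _ (zero_add _).symm
  · exact congrArg _ (h01 _ _ hne)

theorem exists_cl_apply (α : G φ ≃g G φ) (hn : 2 ≤ n) (hocc : ∀ x : Fin n, φ.OccursIn x)
    (c a b) : ∃ c' a' b', α (.cl c a b) = .cl c' a' b' := by
  have hs := mt (isSt_apply α hocc (.cl c a b)).1 (by simp [IsSt])
  have hr := mt (isRt_apply α hocc (.cl c a b)).1 (by simp [IsRt])
  have hl := mt (isLt_apply α hocc (.cl c a b)).1 (by simp [IsLt])
  have hv := mt (isVar_apply α hn hocc (.cl c a b)).1 (by simp [IsVar])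
  cases h : α (.cl c a b) with
  | cl c' a' b' => exact ⟨c', a', b', rfl⟩
  | var x v => exact absurd ⟨x, v, h⟩ hv
  | lt i => exact absurd ⟨i, h⟩ hl
  | rt i => exact absurd ⟨i, h⟩ hr
  | st i => exact absurd ⟨i, h⟩ hs

theorem apply_cl (α : G φ ≃g G φ) (hn : 2 ≤ n) (hocc : ∀ x : Fin n, φ.OccursIn x)
    {T : Fin n → ZMod 2} (hT : ∀ x v, α (.var x v) = .var x (v + T x)) (c a b) :
    α (.cl c a b) = .cl c (a + T c.1.1) (b + T c.1.2.1) ∧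
      T c.1.1 + T c.1.2.1 + T c.1.2.2 = 0 := by
  obtain ⟨c', a', b', h⟩ := exists_cl_apply α hn hocc c a b
  have hadj : ∀ x v, (G φ).Adj (.cl c a b) (.var x v) →
      (G φ).Adj (.cl c' a' b') (.var x (v + T x)) := by
    intro x v hxv
    rw [← h, ← hT]
    exact α.map_adj_iff.2 hxv
  have hx := hadj c.1.1 (1 + a) (by simp)
  have hy := hadj c.1.2.1 (1 + b) (by simp)
  have hz := hadj c.1.2.2 (1 + a + b) (by simp)
  rw [adj_cl_var] at hx hy hz
  obtain ⟨ho₁, ho₂⟩ := φ.ordered _ c.2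
  obtain ⟨ho₁', ho₂'⟩ := φ.ordered _ c'.2
  have hc₁ : c.1.1 = c'.1.1 := by omega
  have hc₂ : c.1.2.1 = c'.1.2.1 := by omega
  have hc₃ : c.1.2.2 = c'.1.2.2 := by omega
  have hc : c = c' := Subtype.ext (Prod.ext hc₁ (Prod.ext hc₂ hc₃))
  subst hc
  simp only [true_and, ho₁.ne, ho₁.ne', ho₂.ne, ho₂.ne', (ho₁.trans ho₂).ne,
    (ho₁.trans ho₂).ne', false_and, or_false, false_or] at hx hy hz
  have ha : a' = a + T c.1.1 := by linear_combination -hx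
  have hb : b' = b + T c.1.2.1 := by linear_combination -hy
  subst ha hb
  refine ⟨h, ?_⟩
  have hz' : T c.1.2.2 = T c.1.1 + T c.1.2.1 := by linear_combination hz
  rw [hz']
  exact CharTwo.add_self_eq_zero _

theorem alphaMap_involutive (T : Fin n → ZMod 2) : Function.Involutive (alphaMap φ T) := by
  intro u
  cases u <;> simp [alphaMap, add_assoc, CharTwo.add_self_eq_zero]

theorem adj_alphaMap {T : Fin n → ZMod 2} (hT : φ.Satisfies T) {u v : Vtx φ}
    (h : (G φ).Adj u v) : (G φ).Adj (alphaMap φ T u) (alphaMap φ T v) := by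
  have key : ∀ {u v : Vtx φ}, Edge φ u v →
      (G φ).Adj (alphaMap φ T u) (alphaMap φ T v) := by
    intro u v h
    cases h with
    | cx c a b => simp [alphaMap, add_assoc]
    | cy c a b => simp [alphaMap, add_assoc]
    | cz c a b =>
      have hz : T c.1.2.2 = T c.1.1 + T c.1.2.1 := by
        rw [← CharTwo.add_eq_zero, add_comm]
        exact hT c.1 c.2
      rw [alphaMap, alphaMap, adj_cl_var]
      exact .inr (.inr ⟨rfl, by rw [hz]; ring⟩)
    | _ => simp [alphaMap]
  rw [G, SimpleGraph.fromRel_adj] at h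
  exact h.2.elim key fun h => (key h).symm

end Automorphisms

end HomXor

open HomXor in
/-- If `n ≥ 2` and every variable occurs in at least one clause of the
homogeneous 3-XOR formula `φ`, then `T ↦ α_T` is a bijection from the set of
satisfying assignments of `φ` onto the set of automorphisms of `G_φ`
(automorphisms taken as the underlying vertex maps of graph isomorphisms
`G_φ ≃g G_φ`). -/
theorem alphaMap_bijection {n : ℕ} (φ : HomXor n) (hn : 2 ≤ n)
    (hocc : ∀ x : Fin n, φ.OccursIn x) :
    Set.BijOn (alphaMap φ) {T : Fin n → ZMod 2 | φ.Satisfies T}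
      {f : Vtx φ → Vtx φ | ∃ α : G φ ≃g G φ, ⇑α = f} := by
  refine ⟨fun T hT => ?_, fun T _ T' _ h => ?_, ?_⟩
  · refine ⟨⟨(alphaMap_involutive T).toPerm, fun {u v} => ⟨fun h => ?_, adj_alphaMap hT⟩⟩, rfl⟩
    have h' := adj_alphaMap hT h
    rwa [Function.Involutive.coe_toPerm, alphaMap_involutive, alphaMap_involutive] at h'
  · funext x
    simpa [alphaMap] using congrFun h (.var x 0)
  · rintro _ ⟨α, rfl⟩
    obtain ⟨T, hT⟩ := exists_shift α hn hocc
    obtain ⟨hst, hrt, hlt, -⟩ := gadget_fixed α hn hocc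
    refine ⟨T, fun c hc => (apply_cl α hn hocc hT ⟨c, hc⟩ 0 0).2, ?_⟩
    funext u
    cases u with
    | cl c a b => exact (apply_cl α hn hocc hT c a b).1.symm
    | var x v => exact (hT x v).symm
    | lt i => exact (hlt i).symm
    | rt i => exact (hrt i).symm
    | st i => exact (hst i).symm
end

section
/- If the bipartite incidence graph Φ of the homogeneous 3-XOR formula φ is asymmetric and φ is uniquely satisfiable, then the graph G^1_φ is asymmetric. -/
open SimpleGraph

namespace HomXor

variable {n : ℕ}

/-- The vertices of the graph `G¹_φ`:
* `cl c a b` is the clause vertex `C_{a b (a+b)}` — note that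
  `{C_{000}, C_{011}, C_{110}, C_{101}}` is exactly the set of `C_{a b c}`
  with `a + b + c = 0` in `𝔽₂`, so the four clause vertices of `C` are
  `cl c a b` for `(a, b) ∈ 𝔽₂ × 𝔽₂`;
* `var x v` is the variable vertex `X_x^v`. -/
inductive Vtx1 (φ : HomXor n) : Type
  | cl (c : {c // c ∈ φ.clauses}) (a b : ZMod 2)
  | var (x : Fin n) (v : ZMod 2)
  deriving DecidableEq

/-- The edges of the graph `G¹_φ`.  For a clause `C` with variables
`x < y < z`, the clause vertex `C_{a b (a+b)}` is adjacent to `x^{1+a}`,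
`y^{1+b}` and `z^{1+a+b}` (this is exactly: `C_{000}` adjacent to
`x^1, y^1, z^1`; `C_{011}` to `x^1, y^0, z^0`; `C_{110}` to `x^0, y^0, z^1`;
`C_{101}` to `x^0, y^1, z^0`).  For each variable `X` there is an edge
between `X^0` and `X^1`. -/
inductive Edge1 (φ : HomXor n) : Vtx1 φ → Vtx1 φ → Prop
  | cx (c : {c // c ∈ φ.clauses}) (a b : ZMod 2) :
      Edge1 φ (Vtx1.cl c a b) (Vtx1.var c.1.1 (1 + a))
  | cy (c : {c // c ∈ φ.clauses}) (a b : ZMod 2) :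
      Edge1 φ (Vtx1.cl c a b) (Vtx1.var c.1.2.1 (1 + b))
  | cz (c : {c // c ∈ φ.clauses}) (a b : ZMod 2) :
      Edge1 φ (Vtx1.cl c a b) (Vtx1.var c.1.2.2 (1 + a + b))
  | xx (x : Fin n) : Edge1 φ (Vtx1.var x 0) (Vtx1.var x 1)

/-- The graph `G¹_φ`. -/
def G1 (φ : HomXor n) : SimpleGraph (Vtx1 φ) := SimpleGraph.fromRel (Edge1 φ)

/-- The incidence relation between clauses and variables of `φ`. -/
def IncRel (φ : HomXor n) :
    ({c // c ∈ φ.clauses} ⊕ Fin n) → ({c // c ∈ φ.clauses} ⊕ Fin n) → Prop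
  | Sum.inl c, Sum.inr x => x = c.1.1 ∨ x = c.1.2.1 ∨ x = c.1.2.2
  | _, _ => False

/-- The bipartite incidence graph `Φ` of `φ`: its vertices are the clauses
and the variables, with an edge between a clause `C` and a variable `X` iff
`X` occurs in `C`. -/
def Inc (φ : HomXor n) : SimpleGraph ({c // c ∈ φ.clauses} ⊕ Fin n) :=
  SimpleGraph.fromRel (IncRel φ)

/-- For an assignment `T`, the map `α_T` on the vertices of `G¹_φ`: each
variable vertex `X^b` is mapped to `X^{b + T(X)}`, and each clause vertex
`C_{a b (a+b)}` (for a clause with variables `x < y < z`) is mapped to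
`C_{a + T(x), b + T(y), (a+b) + T(z)}` — in our indexing by the first two
subscripts, to `cl c (a + T x) (b + T y)`, which is the same vertex since
`T(x) + T(y) + T(z) = 0` for a satisfying assignment. -/
def alphaMap1 {n : ℕ} (φ : HomXor n) (T : Fin n → ZMod 2) : Vtx1 φ → Vtx1 φ
  | Vtx1.cl c a b => Vtx1.cl c (a + T c.1.1) (b + T c.1.2.1)
  | Vtx1.var x v => Vtx1.var x (v + T x)

end HomXor

namespace HomXor

variable {n : ℕ} {φ : HomXor n}

/-- The variable `x` occurs in the clause `c`. -/
def Occurs (x : Fin n) (c : {c // c ∈ φ.clauses}) : Prop :=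
  x = c.1.1 ∨ x = c.1.2.1 ∨ x = c.1.2.2

theorem G1_not_adj_cl_cl (c d : {c // c ∈ φ.clauses}) (a b a' b' : ZMod 2) :
    ¬ (G1 φ).Adj (Vtx1.cl c a b) (Vtx1.cl d a' b') := by
  rintro ⟨-, h | h⟩ <;> cases h

theorem G1_adj_var_var (x y : Fin n) (v w : ZMod 2) :
    (G1 φ).Adj (Vtx1.var x v) (Vtx1.var y w) ↔ x = y ∧ w = v + 1 := by
  constructor
  · rintro ⟨-, h | h⟩ <;> cases h <;> exact ⟨rfl, by decide⟩
  · rintro ⟨rfl, rfl⟩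
    have hv : v = 0 ∨ v = 1 := by revert v; decide
    refine ⟨by simp, ?_⟩
    rcases hv with rfl | rfl
    · exact Or.inl (Edge1.xx x)
    · exact Or.inr (Edge1.xx x)

theorem G1_adj_cl_var (c : {c // c ∈ φ.clauses}) (a b : ZMod 2) (x : Fin n) (v : ZMod 2) :
    (G1 φ).Adj (Vtx1.cl c a b) (Vtx1.var x v) ↔
      (x = c.1.1 ∧ v = 1 + a) ∨ (x = c.1.2.1 ∧ v = 1 + b) ∨ (x = c.1.2.2 ∧ v = 1 + a + b) := by
  constructor
  · rintro ⟨-, h | h⟩ <;> cases h <;> simp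
  · intro h
    refine ⟨by simp, Or.inl ?_⟩
    rcases h with ⟨rfl, rfl⟩ | ⟨rfl, rfl⟩ | ⟨rfl, rfl⟩
    · exact Edge1.cx c a b
    · exact Edge1.cy c a b
    · exact Edge1.cz c a b

theorem Inc_adj_inl_inr (c : {c // c ∈ φ.clauses}) (x : Fin n) :
    (Inc φ).Adj (Sum.inl c) (Sum.inr x) ↔ Occurs x c := by
  simp [Inc, IncRel, Occurs]

theorem occurs_iff_exists_adj (c : {c // c ∈ φ.clauses}) (a b : ZMod 2) (x : Fin n) :
    Occurs x c ↔ ∃ v, (G1 φ).Adj (Vtx1.cl c a b) (Vtx1.var x v) := by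
  simp only [G1_adj_cl_var, Occurs]
  constructor
  · rintro (h | h | h)
    · exact ⟨_, Or.inl ⟨h, rfl⟩⟩
    · exact ⟨_, Or.inr (Or.inl ⟨h, rfl⟩)⟩
    · exact ⟨_, Or.inr (Or.inr ⟨h, rfl⟩)⟩
  · rintro ⟨v, h⟩
    tauto

theorem clause_ext {c d : {c // c ∈ φ.clauses}} (h : ∀ x, Occurs x c ↔ Occurs x d) : c = d := by
  obtain ⟨⟨c₁, c₂, c₃⟩, hc⟩ := c
  obtain ⟨⟨d₁, d₂, d₃⟩, hd⟩ := d
  have oc := φ.ordered _ hc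
  have od := φ.ordered _ hd
  simp only [Occurs] at h oc od
  have e₁ := (h c₁).1 (by simp)
  have e₂ := (h c₂).1 (by simp)
  have e₃ := (h c₃).1 (by simp)
  have f₁ := (h d₁).2 (by simp)
  have f₂ := (h d₂).2 (by simp)
  have f₃ := (h d₃).2 (by simp)
  simp only [Subtype.mk.injEq, Prod.mk.injEq]
  omega

/-- Each literal of a clause has exactly two neighbours among the vertices of that clause. -/
theorem exists_two_clause_neighbors {x : Fin n} {c : {c // c ∈ φ.clauses}} (h : Occurs x c)
    (v : ZMod 2) : ∃ a b a' b', ¬ (a = a' ∧ b = b') ∧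
      (G1 φ).Adj (Vtx1.cl c a b) (Vtx1.var x v) ∧ (G1 φ).Adj (Vtx1.cl c a' b') (Vtx1.var x v) ∧
      ∀ p q, (G1 φ).Adj (Vtx1.cl c p q) (Vtx1.var x v) → (p = a ∧ q = b) ∨ (p = a' ∧ q = b') := by
  have o := φ.ordered c.1 c.2
  have h₁₂ : c.1.1 ≠ c.1.2.1 := o.1.ne
  have h₂₃ : c.1.2.1 ≠ c.1.2.2 := o.2.ne
  have h₁₃ : c.1.1 ≠ c.1.2.2 := (o.1.trans o.2).ne
  simp only [G1_adj_cl_var]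
  rcases h with rfl | rfl | rfl
  · simp only [h₁₂, h₁₃, true_and, false_and, or_false]
    revert v; decide
  · simp only [h₁₂.symm, h₂₃, true_and, false_and, or_false, false_or]
    revert v; decide
  · simp only [h₁₃.symm, h₂₃.symm, true_and, false_and, false_or]
    revert v; decide

/-- The vertex `u` of the graph `G` has at most three neighbours. -/
def AtMostThreeNeighbors {V : Type*} (G : SimpleGraph V) (u : V) : Prop :=
  ∃ p q r, ∀ w, G.Adj u w → w = p ∨ w = q ∨ w = r

theorem AtMostThreeNeighbors.map {V : Type*} {G : SimpleGraph V} {u : V}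
    (h : AtMostThreeNeighbors G u) (α : G ≃g G) : AtMostThreeNeighbors G (α u) := by
  obtain ⟨p, q, r, h⟩ := h
  refine ⟨α p, α q, α r, fun w hw => ?_⟩
  have := h (α.symm w) (by rw [← α.map_adj_iff]; simpa using hw)
  simpa [RelIso.symm_apply_eq] using this

theorem atMostThreeNeighbors_map_iff {V : Type*} {G : SimpleGraph V} (α : G ≃g G) (u : V) :
    AtMostThreeNeighbors G (α u) ↔ AtMostThreeNeighbors G u :=
  ⟨fun h => by simpa using h.map α.symm, fun h => h.map α⟩

theorem atMostThreeNeighbors_cl (c : {c // c ∈ φ.clauses}) (a b : ZMod 2) :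
    AtMostThreeNeighbors (G1 φ) (Vtx1.cl c a b) := by
  refine ⟨Vtx1.var c.1.1 (1 + a), Vtx1.var c.1.2.1 (1 + b), Vtx1.var c.1.2.2 (1 + a + b), ?_⟩
  rintro (⟨d, a', b'⟩ | ⟨x, v⟩) h
  · exact absurd h (G1_not_adj_cl_cl c d a b a' b')
  · simpa [G1_adj_cl_var] using h

theorem atMostThreeNeighbors_var_iff (x : Fin n) (v : ZMod 2) :
    AtMostThreeNeighbors (G1 φ) (Vtx1.var x v) ↔
      ∀ c d : {c // c ∈ φ.clauses}, Occurs x c → Occurs x d → c = d := by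
  constructor
  · rintro ⟨p, q, r, h⟩ c d hc hd
    by_contra hcd
    obtain ⟨a, b, a', b', hne, h₁, h₂, -⟩ := exists_two_clause_neighbors hc v
    obtain ⟨e, f, e', f', hne', h₃, h₄, -⟩ := exists_two_clause_neighbors hd v
    have k₁ := h _ h₁.symm
    have k₂ := h _ h₂.symm
    have k₃ := h _ h₃.symm
    have k₄ := h _ h₄.symm
    grind
  · intro h
    by_cases hx : ∃ c : {c // c ∈ φ.clauses}, Occurs x c
    · obtain ⟨c, hc⟩ := hx
      obtain ⟨a, b, a', b', -, -, -, hall⟩ := exists_two_clause_neighbors hc v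
      refine ⟨Vtx1.cl c a b, Vtx1.cl c a' b', Vtx1.var x (v + 1), ?_⟩
      rintro (⟨d, p, q⟩ | ⟨y, w⟩) hw
      · obtain rfl := h c d hc ((occurs_iff_exists_adj d p q x).2 ⟨v, hw.symm⟩)
        simpa using hall p q hw.symm
      · obtain ⟨rfl, rfl⟩ := (G1_adj_var_var ..).1 hw
        simp
    · refine ⟨Vtx1.var x (v + 1), Vtx1.var x (v + 1), Vtx1.var x (v + 1), ?_⟩
      rintro (⟨d, p, q⟩ | ⟨y, w⟩) hw
      · exact absurd ⟨d, (occurs_iff_exists_adj d p q x).2 ⟨v, hw.symm⟩⟩ hx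
      · obtain ⟨rfl, rfl⟩ := (G1_adj_var_var ..).1 hw
        simp

/-- In a uniquely satisfiable formula every clause has a variable that also occurs in another
clause: otherwise the values of its first two variables can be flipped. -/
theorem exists_shared_variable
    (huniq : ∀ T : Fin n → ZMod 2, φ.Satisfies T → T = fun _ => 0) (c : {c // c ∈ φ.clauses}) :
    ∃ x, Occurs x c ∧ ∃ d : {c // c ∈ φ.clauses}, Occurs x d ∧ c ≠ d := by
  by_contra! hcon
  have o := φ.ordered c.1 c.2
  have h₁₂ : c.1.1 ≠ c.1.2.1 := o.1.ne
  have h₂₃ : c.1.2.1 ≠ c.1.2.2 := o.2.ne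
  have h₁₃ : c.1.1 ≠ c.1.2.2 := (o.1.trans o.2).ne
  have hT := huniq (fun x => if x = c.1.1 ∨ x = c.1.2.1 then 1 else 0) (by
    intro d hd
    by_cases hcd : c = ⟨d, hd⟩
    · subst hcd
      simp only [h₁₃.symm, h₂₃.symm, true_or, or_true, or_self, if_true, if_false]
      decide
    · have key : ∀ x, Occurs x (⟨d, hd⟩ : {c // c ∈ φ.clauses}) →
          ¬ (x = c.1.1 ∨ x = c.1.2.1) := by
        intro x hx hxc
        exact hcd (hcon x (by unfold Occurs; tauto) _ hx)
      simp only [key d.1 (by simp [Occurs]), key d.2.1 (by simp [Occurs]),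
        key d.2.2 (by simp [Occurs]), if_false, add_zero])
  simpa using congrFun hT c.1.1

/-- Variable vertices are recognised by the numbers of neighbours of themselves and of their
neighbours. -/
theorem exists_eq_var_iff
    (huniq : ∀ T : Fin n → ZMod 2, φ.Satisfies T → T = fun _ => 0) (u : Vtx1 φ) :
    (∃ x v, u = Vtx1.var x v) ↔ (AtMostThreeNeighbors (G1 φ) u →
      ∀ w, (G1 φ).Adj u w → AtMostThreeNeighbors (G1 φ) w) := by
  rcases u with ⟨c, a, b⟩ | ⟨x, v⟩
  · simp only [reduceCtorEq, exists_false, false_iff]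
    intro h
    obtain ⟨x, hx, d, hd, hcd⟩ := exists_shared_variable huniq c
    obtain ⟨v, hv⟩ := (occurs_iff_exists_adj c a b x).1 hx
    exact hcd ((atMostThreeNeighbors_var_iff x v).1
      (h (atMostThreeNeighbors_cl c a b) _ hv) c d hx hd)
  · refine iff_of_true ⟨x, v, rfl⟩ ?_
    rintro h (⟨d, p, q⟩ | ⟨y, w⟩) hw
    · exact atMostThreeNeighbors_cl d p q
    · obtain ⟨rfl, -⟩ := (G1_adj_var_var ..).1 hw
      rwa [atMostThreeNeighbors_var_iff] at h ⊢

theorem automorphism_maps_var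
    (huniq : ∀ T : Fin n → ZMod 2, φ.Satisfies T → T = fun _ => 0) (α : G1 φ ≃g G1 φ)
    (x : Fin n) (v : ZMod 2) : ∃ y w, α (Vtx1.var x v) = Vtx1.var y w := by
  rw [exists_eq_var_iff huniq, atMostThreeNeighbors_map_iff]
  intro h w hw
  rw [← α.apply_symm_apply w, atMostThreeNeighbors_map_iff]
  refine (exists_eq_var_iff huniq (Vtx1.var x v)).1 ⟨x, v, rfl⟩ h _ ?_
  rw [← α.map_adj_iff]
  simpa using hw

theorem automorphism_maps_cl
    (huniq : ∀ T : Fin n → ZMod 2, φ.Satisfies T → T = fun _ => 0) (α : G1 φ ≃g G1 φ)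
    (c : {c // c ∈ φ.clauses}) (a b : ZMod 2) :
    ∃ d a' b', α (Vtx1.cl c a b) = Vtx1.cl d a' b' := by
  rcases h : α (Vtx1.cl c a b) with ⟨d, a', b'⟩ | ⟨x, v⟩
  · exact ⟨d, a', b', rfl⟩
  · obtain ⟨y, w, hy⟩ := automorphism_maps_var huniq α.symm x v
    rw [← h, RelIso.symm_apply_apply] at hy
    cases hy

/-- An automorphism of `G¹_φ` permutes variables and clauses compatibly with incidence. -/
theorem automorphism_structure
    (huniq : ∀ T : Fin n → ZMod 2, φ.Satisfies T → T = fun _ => 0) (α : G1 φ ≃g G1 φ) :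
    ∃ (π : Fin n → Fin n) (T : Fin n → ZMod 2)
      (κ : {c // c ∈ φ.clauses} → {c // c ∈ φ.clauses}),
      (∀ x v, α (Vtx1.var x v) = Vtx1.var (π x) (v + T x)) ∧
      (∀ c a b, ∃ a' b', α (Vtx1.cl c a b) = Vtx1.cl (κ c) a' b') ∧
      ∀ c x, Occurs (π x) (κ c) ↔ Occurs x c := by
  choose p s hps using automorphism_maps_var huniq α
  choose k A B hk using automorphism_maps_cl huniq α
  have hvar : ∀ x v, α (Vtx1.var x v) = Vtx1.var (p x 0) (v + s x 0) := by
    intro x v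
    have hv : v = 0 ∨ v = 1 := by revert v; decide
    rcases hv with rfl | rfl
    · simp [hps]
    · have h := α.map_adj_iff.2 ((G1_adj_var_var (φ := φ) x x 0 1).2 ⟨rfl, by decide⟩)
      rw [hps, hps, G1_adj_var_var] at h
      rw [hps, ← h.1, h.2, add_comm]
  have hsurj : ∀ y, ∃ x, y = p x 0 := by
    intro y
    obtain ⟨x, v, h⟩ := automorphism_maps_var huniq α.symm y 0
    refine ⟨x, ?_⟩
    rw [RelIso.symm_apply_eq, hvar] at h
    exact (Vtx1.var.inj h).1
  have hocc : ∀ c a b x, Occurs (p x 0) (k c a b) ↔ Occurs x c := by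
    intro c a b x
    rw [occurs_iff_exists_adj (k c a b) (A c a b) (B c a b), occurs_iff_exists_adj c a b, ← hk]
    constructor
    · rintro ⟨v, hv⟩
      refine ⟨v - s x 0, α.map_adj_iff.1 ?_⟩
      rwa [hvar, sub_add_cancel]
    · rintro ⟨v, hv⟩
      exact ⟨v + s x 0, by rw [← hvar]; exact α.map_adj_iff.2 hv⟩
  refine ⟨fun x => p x 0, fun x => s x 0, fun c => k c 0 0, hvar, fun c a b => ?_,
    fun c => hocc c 0 0⟩
  refine ⟨A c a b, B c a b, ?_⟩
  have : k c a b = k c 0 0 := clause_ext fun y => by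
    obtain ⟨x, rfl⟩ := hsurj y
    rw [hocc, hocc]
  rw [hk, this]

end HomXor

open HomXor in
/-- If the bipartite incidence graph `Φ` of the homogeneous 3-XOR formula `φ`
is asymmetric and `φ` is uniquely satisfiable (the all-zero assignment is its
only satisfying assignment), then the graph `G¹_φ` is asymmetric. -/
theorem G1_asymmetric {n : ℕ} (φ : HomXor n)
    (hasym : ∀ β : Inc φ ≃g Inc φ, ∀ v, β v = v)
    (huniq : ∀ T : Fin n → ZMod 2, φ.Satisfies T → T = fun _ => 0) :
    ∀ α : G1 φ ≃g G1 φ, ∀ v : Vtx1 φ, α v = v := by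
  intro α
  obtain ⟨π, T, κ, hvar, hcl, hocc⟩ := automorphism_structure huniq α
  obtain ⟨π', T', κ', hvar', hcl', -⟩ := automorphism_structure huniq α.symm
  have hπ : ∀ x, π' (π x) = x := fun x => by
    have h := hvar' (π x) (0 + T x)
    rw [← hvar, RelIso.symm_apply_apply] at h
    exact (Vtx1.var.inj h).1.symm
  have hπ' : ∀ x, π (π' x) = x := fun x => by
    have h := hvar (π' x) (0 + T' x)
    rw [← hvar', RelIso.apply_symm_apply] at h
    exact (Vtx1.var.inj h).1.symm
  have hκ : ∀ c, κ' (κ c) = c := fun c => by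
    obtain ⟨a, b, h⟩ := hcl c 0 0
    obtain ⟨a', b', h'⟩ := hcl' (κ c) a b
    rw [← h, RelIso.symm_apply_apply] at h'
    exact (Vtx1.cl.inj h').1.symm
  have hκ' : ∀ c, κ (κ' c) = c := fun c => by
    obtain ⟨a, b, h⟩ := hcl' c 0 0
    obtain ⟨a', b', h'⟩ := hcl (κ' c) a b
    rw [← h, RelIso.apply_symm_apply] at h'
    exact (Vtx1.cl.inj h').1.symm
  let β : Inc φ ≃g Inc φ :=
    { toEquiv := Equiv.sumCongr ⟨κ, κ', hκ, hκ'⟩ ⟨π, π', hπ, hπ'⟩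
      map_rel_iff' := by
        rintro (c | x) (d | y)
        · simp [Inc, IncRel]
        · simpa [Inc_adj_inl_inr] using hocc c y
        · simpa [Inc_adj_inl_inr, (Inc φ).adj_comm (Sum.inr _)] using hocc d x
        · simp [Inc, IncRel] }
  have hκ_id : ∀ c, κ c = c := fun c => Sum.inl.inj (hasym β (Sum.inl c))
  have hπ_id : ∀ x, π x = x := fun x => Sum.inr.inj (hasym β (Sum.inr x))
  simp only [hκ_id, hπ_id] at hvar hcl
  have hcoord : ∀ c a b, α (Vtx1.cl c a b) = Vtx1.cl c (a + T c.1.1) (b + T c.1.2.1) ∧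
      T c.1.1 + T c.1.2.1 + T c.1.2.2 = 0 := by
    intro c a b
    have o := φ.ordered c.1 c.2
    have h₁₂ : c.1.1 ≠ c.1.2.1 := o.1.ne
    have h₂₃ : c.1.2.1 ≠ c.1.2.2 := o.2.ne
    have h₁₃ : c.1.1 ≠ c.1.2.2 := (o.1.trans o.2).ne
    obtain ⟨a', b', h⟩ := hcl c a b
    have hadj : ∀ x v, (G1 φ).Adj (Vtx1.cl c a b) (Vtx1.var x v) →
        (G1 φ).Adj (Vtx1.cl c a' b') (Vtx1.var x (v + T x)) := by
      intro x v hxv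
      rw [← h, ← hvar]
      exact α.map_adj_iff.2 hxv
    have hx := hadj c.1.1 (1 + a) (by simp [G1_adj_cl_var])
    have hy := hadj c.1.2.1 (1 + b) (by simp [G1_adj_cl_var])
    have hz := hadj c.1.2.2 (1 + a + b) (by simp [G1_adj_cl_var])
    simp only [G1_adj_cl_var, h₁₂, h₁₃, h₂₃, h₁₂.symm, h₁₃.symm, h₂₃.symm, true_and, false_and,
      or_false, false_or] at hx hy hz
    have ha : a' = a + T c.1.1 := by linear_combination -hx
    have hb : b' = b + T c.1.2.1 := by linear_combination -hy
    refine ⟨by rw [h, ha, hb], ?_⟩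
    rw [ha, hb] at hz
    generalize T c.1.1 = t₁ at hz ⊢
    generalize T c.1.2.1 = t₂ at hz ⊢
    generalize T c.1.2.2 = t₃ at hz ⊢
    have h₀ : t₃ = t₁ + t₂ := by linear_combination hz
    rw [h₀]
    exact CharTwo.add_self_eq_zero _
  have hT := huniq T fun c hc => (hcoord ⟨c, hc⟩ 0 0).2
  rintro (⟨c, a, b⟩ | ⟨x, v⟩)
  · rw [(hcoord c a b).1, hT, add_zero, add_zero]
  · rw [hvar, hT, add_zero]
end
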